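/- Let k : ℝ → ℂ be a C^∞ function supported in [1,∞) satisfying |∂^α k(t)| ≤ C_α t^{−1−α} for all α ∈ ℕ and t ≥ 1. Then for every a ≥ 0 the improper integral F(a) = lim_{N→∞} ∫_1^N e^{−i(at + t²)} k(t) dt exists, the function F is C^∞ on [0,∞), and for every r, n ∈ ℕ there is a constant C_{r,n}, depending only on r, n and finitely many of the constants C_α, such that |∂_a^r F(a)| ≤ C_{r,n}(1+a)^{−n} for all a ≥ 0. -/

import Mathlib

open Real Filter Topology MeasureTheory ENNReal NNReal

noncomputable section

/-- `eI r = exp(i r)`. -/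
def eI (r : ℝ) : ℂ := Complex.exp (Complex.I * r)

/-- A normalized bump function on `ℝ`: a `C^∞` function supported in `[-1,1]`
with `|φ| ≤ 1` and `|φ'| ≤ 1`. -/
def IsNormalizedBump (φ : ℝ → ℝ) : Prop :=
  ContDiff ℝ (⊤ : ℕ∞) φ ∧ (∀ t : ℝ, 1 < |t| → φ t = 0) ∧
  (∀ t, |φ t| ≤ 1) ∧ (∀ t, |deriv φ t| ≤ 1)

/-- A smooth function supported in `[1,∞)` whose derivatives obey the Calderón–Zygmund decay
bounds with constants `Cd`. -/
structure IsDecayingSymbol (Cd : ℕ → ℝ) (k : ℝ → ℂ) : Prop where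
  smooth : ContDiff ℝ (⊤ : ℕ∞) k
  support : ∀ t : ℝ, t < 1 → k t = 0
  bound : ∀ (α : ℕ) (t : ℝ), 1 ≤ t → ‖iteratedDeriv α k t‖ ≤ Cd α * t ^ (-1 - (α : ℝ))

/-- The integrand `e^{-i(at+t²)} t^p k^{(j)}(t) (a+2t)^{-q}`. -/
def phaseKernel (k : ℝ → ℂ) (j p q : ℕ) (a t : ℝ) : ℂ :=
  eI (-(a * t + t ^ 2)) * (t : ℂ) ^ p * iteratedDeriv j k t * (((a : ℂ) + 2 * t) ^ q)⁻¹

/-- The absolutely convergent integral of `phaseKernel` over `(1,∞)`. -/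
def phaseIntegral (k : ℝ → ℂ) (j p q : ℕ) (a : ℝ) : ℂ :=
  ∫ t in Set.Ioi (1 : ℝ), phaseKernel k j p q a t

theorem norm_eI (x : ℝ) : ‖eI x‖ = 1 := by
  rw [eI, mul_comm]
  exact Complex.norm_exp_ofReal_mul_I x

theorem hasDerivAt_eI_comp {f : ℝ → ℝ} {f' x : ℝ} (hf : HasDerivAt f f' x) :
    HasDerivAt (fun y => eI (f y)) (Complex.I * f' * eI (f x)) x := by
  have h := (hf.ofReal_comp.const_mul Complex.I).cexp
  refine h.congr_deriv ?_
  simp only [eI]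
  ring

theorem hasDerivAt_inv_pow_comp {f : ℝ → ℂ} {f' : ℂ} {x : ℝ} (hf : HasDerivAt f f' x)
    (h0 : f x ≠ 0) (q : ℕ) :
    HasDerivAt (fun y => (f y ^ q)⁻¹) (-(q * f' * (f x ^ (q + 1))⁻¹)) x := by
  have h := (hf.pow q).inv (pow_ne_zero q h0)
  refine h.congr_deriv ?_
  rcases q with _ | q
  · simp
  · simp only [Nat.add_sub_cancel, Pi.pow_apply]
    field_simp
    ring

theorem ofReal_add_two_mul_ne_zero {a t : ℝ} (h : 0 < a + 2 * t) : (a : ℂ) + 2 * t ≠ 0 := by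
  exact_mod_cast h.ne'

namespace IsDecayingSymbol

variable {Cd : ℕ → ℝ} {k : ℝ → ℂ}

theorem const_nonneg (hk : IsDecayingSymbol Cd k) (j : ℕ) : 0 ≤ Cd j := by
  have h := (norm_nonneg _).trans (hk.bound j 1 le_rfl)
  simpa using h

theorem continuous_iteratedDeriv (hk : IsDecayingSymbol Cd k) (j : ℕ) :
    Continuous (iteratedDeriv j k) :=
  hk.smooth.continuous_iteratedDeriv j (by exact_mod_cast le_top)

theorem hasDerivAt_iteratedDeriv (hk : IsDecayingSymbol Cd k) (j : ℕ) (t : ℝ) :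
    HasDerivAt (iteratedDeriv j k) (iteratedDeriv (j + 1) k t) t := by
  rw [iteratedDeriv_succ]
  exact ((hk.smooth.differentiable_iteratedDeriv j
    (by exact_mod_cast ENat.natCast_lt_top j)) t).hasDerivAt

theorem iteratedDeriv_one_eq_zero (hk : IsDecayingSymbol Cd k) (j : ℕ) :
    iteratedDeriv j k 1 = 0 := by
  have hc : IsClosed {t | iteratedDeriv j k t = 0} :=
    isClosed_eq (hk.continuous_iteratedDeriv j) continuous_const
  have hsub : Set.Iio (1 : ℝ) ⊆ {t | iteratedDeriv j k t = 0} := by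
    intro t ht
    have he : k =ᶠ[𝓝 t] fun _ => (0 : ℂ) := by
      filter_upwards [Iio_mem_nhds ht] with s hs using hk.support s hs
    have := he.iteratedDeriv_eq j
    simpa [iteratedDeriv_const] using this
  have h := closure_minimal hsub hc
  rw [closure_Iio] at h
  exact h (Set.mem_Iic.2 le_rfl)

theorem norm_phaseKernel_le (hk : IsDecayingSymbol Cd k) {j p q n : ℕ}
    (hpq : p + n + 1 ≤ j + q) (hnq : n ≤ q) {B a t : ℝ} (ht : 1 ≤ t) (hB : 0 < B)
    (hBt : B ≤ a + 2 * t) (hat : t ≤ a + 2 * t) :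
    ‖phaseKernel k j p q a t‖ ≤ Cd j * (B ^ n)⁻¹ * t ^ (-2 : ℝ) := by
  have ht0 : 0 < t := by linarith
  have hx : 0 < a + 2 * t := by linarith
  have hnorm : ‖(a : ℂ) + 2 * t‖ = a + 2 * t := by
    have h := Complex.norm_of_nonneg hx.le
    push_cast at h
    exact h
  have hpow : ((a + 2 * t) ^ q)⁻¹ ≤ (B ^ n)⁻¹ * (t ^ (q - n))⁻¹ := by
    rw [← mul_inv]
    apply inv_anti₀ (by positivity)
    calc B ^ n * t ^ (q - n) ≤ (a + 2 * t) ^ n * (a + 2 * t) ^ (q - n) := by gcongr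
      _ = (a + 2 * t) ^ q := by rw [← pow_add, Nat.add_sub_cancel' hnq]
  have hexp : t ^ p * t ^ (-1 - (j : ℝ)) * (t ^ (q - n))⁻¹ ≤ t ^ (-2 : ℝ) := by
    rw [← Real.rpow_natCast t p, ← Real.rpow_natCast t (q - n), ← Real.rpow_neg ht0.le, ← rpow_add ht0,
      ← rpow_add ht0]
    apply rpow_le_rpow_of_exponent_le ht
    have h : (p : ℝ) + n + 1 ≤ j + q := by exact_mod_cast hpq
    rw [Nat.cast_sub hnq]
    linarith
  have hC := hk.const_nonneg j
  rw [phaseKernel, norm_mul, norm_mul, norm_mul, norm_eI, norm_inv, norm_pow, norm_pow, hnorm,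
    Complex.norm_real, norm_of_nonneg ht0.le, one_mul]
  calc t ^ p * ‖iteratedDeriv j k t‖ * ((a + 2 * t) ^ q)⁻¹
      ≤ t ^ p * (Cd j * t ^ (-1 - (j : ℝ))) * ((B ^ n)⁻¹ * (t ^ (q - n))⁻¹) := by
        gcongr
        exact hk.bound j t ht
    _ = Cd j * (B ^ n)⁻¹ * (t ^ p * t ^ (-1 - (j : ℝ)) * (t ^ (q - n))⁻¹) := by ring
    _ ≤ Cd j * (B ^ n)⁻¹ * t ^ (-2 : ℝ) := by gcongr

theorem norm_phaseKernel_le_rpow_neg_two (hk : IsDecayingSymbol Cd k) {j p q : ℕ}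
    (hpq : p + 1 ≤ j + q) {a t : ℝ} (ht : 1 ≤ t) (ha : -1 ≤ a) :
    ‖phaseKernel k j p q a t‖ ≤ Cd j * t ^ (-2 : ℝ) := by
  have h := hk.norm_phaseKernel_le (n := 0) (B := 1) (a := a) (by simpa using hpq)
    (Nat.zero_le q) ht one_pos (by linarith) (by linarith)
  simpa using h

theorem hasDerivAt_phaseKernel (hk : IsDecayingSymbol Cd k) (j q : ℕ) {a t : ℝ}
    (h : 0 < a + 2 * t) :
    HasDerivAt (fun t => Complex.I * phaseKernel k j 0 (q + 1) a t)
      (phaseKernel k j 0 q a t + Complex.I * phaseKernel k (j + 1) 0 (q + 1) a t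
        - 2 * (q + 1) * Complex.I * phaseKernel k j 0 (q + 2) a t) t := by
  have hne := ofReal_add_two_mul_ne_zero h
  have h1 : HasDerivAt (fun t : ℝ => -(a * t + t ^ 2)) (-(a + 2 * t)) t := by
    exact (((hasDerivAt_id t).const_mul a).add (hasDerivAt_pow 2 t)).neg.congr_deriv (by simp)
  have h2 : HasDerivAt (fun t : ℝ => (a : ℂ) + 2 * t) 2 t := by
    simpa using ((hasDerivAt_id t).ofReal_comp.const_mul (2 : ℂ)).const_add (a : ℂ)
  have h3 := ((hasDerivAt_eI_comp h1).mul (hk.hasDerivAt_iteratedDeriv j t)).mul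
    (hasDerivAt_inv_pow_comp h2 hne (q + 1))
  have h4 := h3.const_mul Complex.I
  simp only [phaseKernel, pow_zero, mul_one]
  refine h4.congr_deriv ?_
  simp only [Pi.mul_apply]
  push_cast
  have hq : (((a : ℂ) + 2 * t) ^ q)⁻¹ = ((a : ℂ) + 2 * t) * (((a : ℂ) + 2 * t) ^ (q + 1))⁻¹ := by
    rw [pow_succ']
    field_simp
  rw [hq]
  generalize (((a : ℂ) + 2 * t) ^ (q + 1))⁻¹ = w
  linear_combination (-(eI (-(a * t + t ^ 2)) * iteratedDeriv j k t * (a + 2 * t) * w))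
    * Complex.I_sq

theorem hasDerivAt_phaseKernel_param (k : ℝ → ℂ) (j p q : ℕ) {a t : ℝ} (h : 0 < a + 2 * t) :
    HasDerivAt (fun a => phaseKernel k j p q a t)
      (-Complex.I * phaseKernel k j (p + 1) q a t - q * phaseKernel k j p (q + 1) a t) a := by
  have hne := ofReal_add_two_mul_ne_zero h
  have h1 : HasDerivAt (fun a : ℝ => -(a * t + t ^ 2)) (-t) a := by
    exact (((hasDerivAt_id a).mul_const t).add_const (t ^ 2)).neg.congr_deriv (by simp)
  have h2 : HasDerivAt (fun a : ℝ => (a : ℂ) + 2 * t) 1 a := by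
    simpa using (hasDerivAt_id a).ofReal_comp.add_const ((2 : ℂ) * t)
  have h3 := (((hasDerivAt_eI_comp h1).mul_const ((t : ℂ) ^ p)).mul_const
    (iteratedDeriv j k t)).mul (hasDerivAt_inv_pow_comp h2 hne q)
  refine h3.congr_deriv ?_
  simp only [phaseKernel]
  push_cast
  ring

theorem continuousOn_phaseKernel (hk : IsDecayingSymbol Cd k) (j p q : ℕ) {a : ℝ} (ha : -1 ≤ a) :
    ContinuousOn (phaseKernel k j p q a) (Set.Ici 1) := by
  have hd := hk.continuous_iteratedDeriv j
  unfold phaseKernel eI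
  refine ContinuousOn.mul (by fun_prop) (ContinuousOn.inv₀ (by fun_prop) fun t ht => ?_)
  have ht' : 1 ≤ t := ht
  exact pow_ne_zero _ (ofReal_add_two_mul_ne_zero (by linarith))

theorem aestronglyMeasurable_phaseKernel (hk : IsDecayingSymbol Cd k) (j p q : ℕ) {a : ℝ}
    (ha : -1 ≤ a) :
    AEStronglyMeasurable (phaseKernel k j p q a) (volume.restrict (Set.Ioi 1)) :=
  ((hk.continuousOn_phaseKernel j p q ha).mono Set.Ioi_subset_Ici_self).aestronglyMeasurable
    measurableSet_Ioi

theorem integrableOn_rpow_neg_two : IntegrableOn (fun t : ℝ => t ^ (-2 : ℝ)) (Set.Ioi 1) :=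
  integrableOn_Ioi_rpow_of_lt (by norm_num) one_pos

theorem integrableOn_phaseKernel (hk : IsDecayingSymbol Cd k) {j p q : ℕ}
    (hpq : p + 1 ≤ j + q) {a : ℝ} (ha : -1 ≤ a) :
    IntegrableOn (phaseKernel k j p q a) (Set.Ioi 1) := by
  refine Integrable.mono' (integrableOn_rpow_neg_two.const_mul (Cd j))
    (hk.aestronglyMeasurable_phaseKernel j p q ha) ?_
  filter_upwards [ae_restrict_mem measurableSet_Ioi] with t ht
  exact hk.norm_phaseKernel_le_rpow_neg_two hpq (le_of_lt ht) ha

theorem hasDerivAt_phaseIntegral (hk : IsDecayingSymbol Cd k) {j p q : ℕ}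
    (hpq : p + 2 ≤ j + q) {a : ℝ} (ha : 0 ≤ a) :
    HasDerivAt (phaseIntegral k j p q)
      (-Complex.I * phaseIntegral k j (p + 1) q a - q * phaseIntegral k j p (q + 1) a) a := by
  have hball : ∀ x ∈ Metric.ball a 1, -1 ≤ x := by
    intro x hx
    rw [Metric.mem_ball, Real.dist_eq, abs_lt] at hx
    linarith
  have ha' : -1 ≤ a := by linarith
  have i1 := hk.integrableOn_phaseKernel (j := j) (p := p + 1) (q := q) (by omega) ha'
  have i2 := hk.integrableOn_phaseKernel (j := j) (p := p) (q := q + 1) (by omega) ha'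
  have h := (hasDerivAt_integral_of_dominated_loc_of_deriv_le
    (μ := volume.restrict (Set.Ioi (1 : ℝ))) (F := fun a t => phaseKernel k j p q a t)
    (F' := fun a t => -Complex.I * phaseKernel k j (p + 1) q a t
      - q * phaseKernel k j p (q + 1) a t) (x₀ := a)
    (bound := fun t => Cd j * t ^ (-2 : ℝ) + q * (Cd j * t ^ (-2 : ℝ)))
    (Metric.ball_mem_nhds a one_pos)
    (by
      filter_upwards [Metric.ball_mem_nhds a one_pos] with x hx
      exact hk.aestronglyMeasurable_phaseKernel j p q (hball x hx))
    (hk.integrableOn_phaseKernel (by omega) ha')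
    ((i1.const_mul _).sub (i2.const_mul _)).aestronglyMeasurable
    (by
      filter_upwards [ae_restrict_mem measurableSet_Ioi] with t ht x hx
      refine (norm_sub_le _ _).trans ?_
      rw [norm_mul, norm_mul, norm_neg, Complex.norm_I, one_mul, Complex.norm_natCast]
      gcongr
      · exact hk.norm_phaseKernel_le_rpow_neg_two (by omega) (le_of_lt ht) (hball x hx)
      · exact hk.norm_phaseKernel_le_rpow_neg_two (by omega) (le_of_lt ht) (hball x hx))
    ((integrableOn_rpow_neg_two.const_mul _).add
      ((integrableOn_rpow_neg_two.const_mul _).const_mul _))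
    (by
      filter_upwards [ae_restrict_mem measurableSet_Ioi] with t ht x hx
      have h1 := hball x hx
      have h2 : 1 < t := ht
      exact hasDerivAt_phaseKernel_param k j p q (by linarith))).2
  rw [integral_sub (i1.const_mul _) (i2.const_mul _), integral_const_mul,
    integral_const_mul] at h
  exact h

theorem norm_phaseIntegral_le (hk : IsDecayingSymbol Cd k) {j p q n : ℕ}
    (hpq : p + n + 1 ≤ j + q) (hnq : n ≤ q) {a : ℝ} (ha : 0 ≤ a) :
    ‖phaseIntegral k j p q a‖
      ≤ (Cd j * ∫ t in Set.Ioi (1 : ℝ), t ^ (-2 : ℝ)) * (1 + a) ^ (-(n : ℝ)) := by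
  have h : ‖phaseIntegral k j p q a‖
      ≤ ∫ t in Set.Ioi (1 : ℝ), Cd j * ((1 + a) ^ n)⁻¹ * t ^ (-2 : ℝ) := by
    refine norm_integral_le_of_norm_le (integrableOn_rpow_neg_two.const_mul _) ?_
    filter_upwards [ae_restrict_mem measurableSet_Ioi] with t ht
    have ht' : 1 < t := ht
    exact hk.norm_phaseKernel_le hpq hnq ht'.le (by linarith) (by linarith) (by linarith)
  rw [integral_const_mul] at h
  rw [Real.rpow_neg (by linarith), Real.rpow_natCast]
  linarith

end IsDecayingSymbol

/-- `F` is `C^r` on `[0,∞)` and its `r`-th derivative is at most `C (1+a)^{-n}`. -/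
def HasDerivDecay (r n : ℕ) (C : ℝ) (F : ℝ → ℂ) : Prop :=
  ContDiffOn ℝ r F (Set.Ici 0) ∧
    ∀ a : ℝ, 0 ≤ a → ‖iteratedDerivWithin r F (Set.Ici 0) a‖ ≤ C * (1 + a) ^ (-(n : ℝ))

namespace HasDerivDecay

variable {r n : ℕ}

theorem linear_comb {C₁ C₂ : ℝ} {F₁ F₂ : ℝ → ℂ} (h₁ : HasDerivDecay r n C₁ F₁)
    (h₂ : HasDerivDecay r n C₂ F₂) (c₁ c₂ : ℂ) :
    HasDerivDecay r n (‖c₁‖ * C₁ + ‖c₂‖ * C₂) (fun a => c₁ * F₁ a + c₂ * F₂ a) := by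
  refine ⟨(contDiffOn_const.mul h₁.1).add (contDiffOn_const.mul h₂.1), fun a ha => ?_⟩
  have hu := uniqueDiffOn_Ici (0 : ℝ)
  have e1 := h₁.1 a ha
  have e2 := h₂.1 a ha
  have heq : iteratedDerivWithin r (fun a => c₁ * F₁ a + c₂ * F₂ a) (Set.Ici 0) a
      = c₁ * iteratedDerivWithin r F₁ (Set.Ici 0) a
        + c₂ * iteratedDerivWithin r F₂ (Set.Ici 0) a := by
    rw [iteratedDerivWithin_fun_add (Set.mem_Ici.2 ha) hu (contDiffWithinAt_const.mul e1)
      (contDiffWithinAt_const.mul e2), iteratedDerivWithin_const_mul (Set.mem_Ici.2 ha) hu c₁ e1,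
      iteratedDerivWithin_const_mul (Set.mem_Ici.2 ha) hu c₂ e2]
  rw [heq]
  refine (norm_add_le _ _).trans ?_
  rw [norm_mul, norm_mul, add_mul, mul_assoc, mul_assoc]
  gcongr
  · exact h₁.2 a ha
  · exact h₂.2 a ha

theorem congr {C : ℝ} {F G : ℝ → ℂ} (h : HasDerivDecay r n C F)
    (hFG : Set.EqOn G F (Set.Ici 0)) : HasDerivDecay r n C G := by
  refine ⟨h.1.congr hFG, fun a ha => ?_⟩
  rw [iteratedDerivWithin_congr hFG ha]
  exact h.2 a ha

theorem of_hasDerivWithinAt {C : ℝ} {F F' : ℝ → ℂ} (h : HasDerivDecay r n C F')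
    (hF : ∀ a ∈ Set.Ici (0 : ℝ), HasDerivWithinAt F (F' a) (Set.Ici 0) a) :
    HasDerivDecay (r + 1) n C F := by
  have hu := uniqueDiffOn_Ici (0 : ℝ)
  have he : Set.EqOn (derivWithin F (Set.Ici 0)) F' (Set.Ici 0) :=
    fun a ha => (hF a ha).derivWithin (hu a ha)
  have h' := h.congr he
  refine ⟨?_, fun a ha => ?_⟩
  · push_cast
    rw [contDiffOn_succ_iff_derivWithin hu]
    exact ⟨fun a ha => (hF a ha).differentiableWithinAt, by simp, h'.1⟩
  · rw [iteratedDerivWithin_succ']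
    exact h'.2 a ha

end HasDerivDecay

theorem exists_hasDerivDecay_phaseIntegral (Cd : ℕ → ℝ) (n j r : ℕ) :
    ∀ p q : ℕ, p + r + n + 2 ≤ j + q → n ≤ q →
      ∃ C, ∀ k, IsDecayingSymbol Cd k → HasDerivDecay r n C (phaseIntegral k j p q) := by
  induction r with
  | zero =>
    intro p q hpq hnq
    refine ⟨Cd j * ∫ t in Set.Ioi (1 : ℝ), t ^ (-2 : ℝ), fun k hk => ⟨?_, fun a ha => ?_⟩⟩
    · rw [Nat.cast_zero, contDiffOn_zero]
      exact fun a ha =>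
        (hk.hasDerivAt_phaseIntegral (by omega) ha).continuousAt.continuousWithinAt
    · rw [iteratedDerivWithin_zero]
      exact hk.norm_phaseIntegral_le (by omega) hnq ha
  | succ r ih =>
    intro p q hpq hnq
    obtain ⟨C₁, h₁⟩ := ih (p + 1) q (by omega) hnq
    obtain ⟨C₂, h₂⟩ := ih p (q + 1) (by omega) (by omega)
    refine ⟨_, fun k hk => ((h₁ k hk).linear_comb (h₂ k hk)
      (-Complex.I) (-(q : ℂ))).of_hasDerivWithinAt fun a ha => ?_⟩
    have h := hk.hasDerivAt_phaseIntegral (j := j) (p := p) (q := q) (by omega) ha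
    exact h.hasDerivWithinAt.congr_deriv (by ring)

/-- Repeated integration by parts: each step raises `q`, until the integral converges absolutely
together with enough derivatives in `a`. -/
theorem exists_tendsto_hasDerivDecay (Cd : ℕ → ℝ) (r n m : ℕ) :
    ∀ j q : ℕ, r + n + 2 ≤ q + m →
      ∃ C, ∀ k, IsDecayingSymbol Cd k → ∃ F : ℝ → ℂ,
        (∀ a : ℝ, 0 ≤ a →
          Tendsto (fun N : ℝ => ∫ t in (1 : ℝ)..N, phaseKernel k j 0 q a t) atTop (𝓝 (F a))) ∧
        HasDerivDecay r n C F := by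
  induction m with
  | zero =>
    intro j q hq
    obtain ⟨C, hC⟩ := exists_hasDerivDecay_phaseIntegral Cd n j r 0 q (by omega) (by omega)
    exact ⟨C, fun k hk => ⟨_, fun a ha => intervalIntegral_tendsto_integral_Ioi 1
      (hk.integrableOn_phaseKernel (by omega) (by linarith)) tendsto_id, hC k hk⟩⟩
  | succ m ih =>
    intro j q hq
    obtain ⟨C₁, h₁⟩ := ih (j + 1) (q + 1) (by omega)
    obtain ⟨C₂, h₂⟩ := ih j (q + 2) (by omega)
    refine ⟨‖-Complex.I‖ * C₁ + ‖2 * ((q : ℂ) + 1) * Complex.I‖ * C₂, fun k hk => ?_⟩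
    obtain ⟨F₁, hT₁, hD₁⟩ := h₁ k hk
    obtain ⟨F₂, hT₂, hD₂⟩ := h₂ k hk
    refine ⟨_, fun a ha => ?_, hD₁.linear_comb hD₂ (-Complex.I) (2 * (q + 1) * Complex.I)⟩
    have ha' : -1 ≤ a := by linarith
    have hb : Tendsto (fun N : ℝ => Complex.I * phaseKernel k j 0 (q + 1) a N) atTop (𝓝 0) := by
      have h0 : Tendsto (fun N : ℝ => Cd j * N ^ (-2 : ℝ)) atTop (𝓝 0) := by
        simpa using (tendsto_rpow_neg_atTop two_pos).const_mul (Cd j)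
      refine squeeze_zero_norm' ?_ h0
      filter_upwards [eventually_ge_atTop 1] with N hN
      rw [norm_mul, Complex.norm_I, one_mul]
      exact hk.norm_phaseKernel_le_rpow_neg_two (by omega) hN ha'
    have hlim := hb.add (((hT₁ a ha).const_mul (-Complex.I)).add
      ((hT₂ a ha).const_mul (2 * (q + 1) * Complex.I)))
    rw [zero_add] at hlim
    refine hlim.congr' ?_
    filter_upwards [eventually_ge_atTop 1] with N hN
    have hi : ∀ j q, IntervalIntegrable (phaseKernel k j 0 q a) volume 1 N := fun j q =>
      ((hk.continuousOn_phaseKernel j 0 q ha').mono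
        (by rw [Set.uIcc_of_le hN]; exact Set.Icc_subset_Ici_self)).intervalIntegrable
    have hi₁ := (hi (j + 1) (q + 1)).const_mul Complex.I
    have hi₂ := (hi j (q + 2)).const_mul (2 * (q + 1) * Complex.I)
    have hftc := intervalIntegral.integral_eq_sub_of_hasDerivAt (a := 1) (b := N)
      (fun t ht => hk.hasDerivAt_phaseKernel j q (a := a) (by
        rw [Set.uIcc_of_le hN] at ht
        linarith [ht.1])) (((hi j q).add hi₁).sub hi₂)
    rw [intervalIntegral.integral_sub ((hi j q).add hi₁) hi₂,
      intervalIntegral.integral_add (hi j q) hi₁, intervalIntegral.integral_const_mul,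
      intervalIntegral.integral_const_mul] at hftc
    have hone : phaseKernel k j 0 (q + 1) a 1 = 0 := by
      simp [phaseKernel, hk.iteratedDeriv_one_eq_zero j]
    rw [hone] at hftc
    linear_combination -hftc

/-- Nonstationary-phase estimate: for a smooth function `k` supported in
`[1,∞)` with CZ decay, the improper integral `F(a) = lim_{N→∞} ∫_1^N e^{-i(at+t²)} k(t) dt`
exists for every `a ≥ 0`, is `C^∞` on `[0,∞)`, and all its derivatives decay in `a` faster
than any power, with constants depending only on the decay constants of `k`. -/
theorem nonstationary_phase_rapid_decay (Cd : ℕ → ℝ) :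
    ∀ r n : ℕ, ∃ C : ℝ, ∀ k : ℝ → ℂ,
      ContDiff ℝ (⊤ : ℕ∞) k →
      (∀ t : ℝ, t < 1 → k t = 0) →
      (∀ (α : ℕ) (t : ℝ), 1 ≤ t → ‖iteratedDeriv α k t‖ ≤ Cd α * t ^ (-1 - (α : ℝ))) →
      ∃ F : ℝ → ℂ,
        (∀ a : ℝ, 0 ≤ a →
          Tendsto (fun N : ℝ => ∫ t in (1:ℝ)..N, eI (-(a * t + t ^ 2)) * k t)
            atTop (𝓝 (F a))) ∧
        ContDiffOn ℝ (⊤ : ℕ∞) F (Set.Ici 0) ∧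
        (∀ a : ℝ, 0 ≤ a →
          ‖iteratedDerivWithin r F (Set.Ici 0) a‖ ≤ C * (1 + a) ^ (-(n : ℝ))) := by
  intro r n
  have key := fun r n => exists_tendsto_hasDerivDecay Cd r n (r + n + 2) 0 0 (by omega)
  obtain ⟨C, hC⟩ := key r n
  refine ⟨C, fun k hs h0 hb => ?_⟩
  have hk : IsDecayingSymbol Cd k := ⟨hs, h0, hb⟩
  obtain ⟨F, hT, hD⟩ := hC k hk
  refine ⟨F, fun a ha => ?_, ?_, hD.2⟩
  · simpa [phaseKernel] using hT a ha
  · rw [contDiffOn_infty]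
    intro s
    obtain ⟨C', hC'⟩ := key s 0
    obtain ⟨G, hTG, hDG⟩ := hC' k hk
    exact hDG.1.congr fun a ha => tendsto_nhds_unique (hT a ha) (hTG a ha)
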